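/- Let D ⊆ ℂ be a connected open set, let n, m, N ≥ 1 be integers, and let a, b, c be real numbers. Let F : D → ℂ^n, G : D → 𝔹^m, and L : D → ℂ^N be holomorphic maps, each of which is nonconstant. If the real-valued function u(z) = a·‖F(z)‖² − b·log(1 − ‖G(z)‖²) + c·log(1 + ‖L(z)‖²) is harmonic on D, then a = b = c = 0. -/

import Mathlib

/-- The Laplacian of a function `u : ℂ → ℝ`, viewed via the real second
derivatives in the directions `1` and `I`. -/
noncomputable def complexLaplacian (u : ℂ → ℝ) (z : ℂ) : ℝ :=
  iteratedFDeriv ℝ 2 u z ![1, 1] + iteratedFDeriv ℝ 2 u z ![Complex.I, Complex.I]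

/-- A real-valued function on an open set `D ⊆ ℂ` is harmonic if it is `C²`
and its Laplacian vanishes on `D`. -/
def HarmonicOn (u : ℂ → ℝ) (D : Set ℂ) : Prop :=
  ContDiffOn ℝ 2 u D ∧ ∀ z ∈ D, complexLaplacian u z = 0

open Filter Topology

/-- A polynomial taking infinitely many values on a set is unbounded on its Zariski closure. -/
theorem MvPolynomial.exists_mem_zeroLocus_lt_norm_eval {ι : Type} [Finite ι]
    (V : Set (ι → ℂ)) (p : MvPolynomial ι ℂ)
    (hp : ((fun v => MvPolynomial.eval v p) '' V).Infinite) (R : ℝ) :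
    ∃ v : ι → ℂ, (∀ q : MvPolynomial ι ℂ, (∀ u ∈ V, MvPolynomial.eval u q = 0) →
      MvPolynomial.eval v q = 0) ∧ R < ‖MvPolynomial.eval v p‖ := by
  classical
  by_contra! hcon
  have hinv : ∀ l : {l : ℂ // R < ‖l‖}, ∃ q : MvPolynomial ι ℂ,
      ∀ u ∈ V, (MvPolynomial.eval u p - l) * MvPolynomial.eval u q = 1 := by
    rintro ⟨l, hl⟩
    set I := MvPolynomial.vanishingIdeal ℂ V
    set J := I ⊔ Ideal.span {p - MvPolynomial.C l}
    have hempty : MvPolynomial.zeroLocus ℂ J = ∅ := by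
      rw [Set.eq_empty_iff_forall_notMem]
      intro v hv
      rw [MvPolynomial.mem_zeroLocus_iff] at hv
      have h1 := hcon v fun q hq => by
        have := hv q (Ideal.mem_sup_left (MvPolynomial.mem_vanishingIdeal_iff.2 (by simpa using hq)))
        simpa using this
      have h2 := hv (p - MvPolynomial.C l)
        (Ideal.mem_sup_right (Ideal.mem_span_singleton_self _))
      simp [sub_eq_zero] at h2
      rw [h2] at h1
      linarith
    have htop : J = ⊤ := by
      rw [← Ideal.radical_eq_top, ← MvPolynomial.vanishingIdeal_zeroLocus_eq_radical (K := ℂ),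
        hempty, MvPolynomial.vanishingIdeal_empty]
    have h1 : (1 : MvPolynomial ι ℂ) ∈ J := by rw [htop]; trivial
    obtain ⟨f, hf, g, hg, hfg⟩ := Submodule.mem_sup.1 h1
    obtain ⟨q, rfl⟩ := Ideal.mem_span_singleton'.1 hg
    refine ⟨q, fun u hu => ?_⟩
    have := congrArg (MvPolynomial.eval u) hfg
    have hfu := MvPolynomial.mem_vanishingIdeal_iff.1 hf u hu
    simp at this hfu
    rw [hfu] at this
    linear_combination this
  choose q hq using hinv
  have hli : LinearIndependent ℂ q := by
    rw [linearIndependent_iff']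
    intro s g hg i hi
    set W : Polynomial ℂ := ∑ k ∈ s, Polynomial.C (g k) *
      ∏ j ∈ s.erase k, (Polynomial.X - Polynomial.C (j : ℂ))
    have hW : W = 0 := by
      refine Polynomial.eq_zero_of_infinite_isRoot W (hp.mono ?_)
      rintro _ ⟨u, hu, rfl⟩
      have h0 : ∑ k ∈ s, g k * MvPolynomial.eval u (q k) = 0 := by
        simpa [MvPolynomial.smul_eval] using congrArg (MvPolynomial.eval u) hg
      have : W.eval (MvPolynomial.eval u p) =
          (∏ j ∈ s, (MvPolynomial.eval u p - j)) * ∑ k ∈ s, g k * MvPolynomial.eval u (q k) := by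
        simp only [W, Polynomial.eval_finsetSum, Polynomial.eval_mul, Polynomial.eval_C,
          Polynomial.eval_prod, Polynomial.eval_sub, Polynomial.eval_X, Finset.mul_sum]
        refine Finset.sum_congr rfl fun k hk => ?_
        rw [← Finset.mul_prod_erase s _ hk]
        linear_combination (- g k * ∏ j ∈ s.erase k, (MvPolynomial.eval u p - j)) * hq k u hu
      simp [Polynomial.IsRoot, this, h0]
    have hWi : W.eval (i : ℂ) = g i * ∏ j ∈ s.erase i, ((i : ℂ) - j) := by
      simp only [W, Polynomial.eval_finsetSum, Polynomial.eval_mul, Polynomial.eval_C,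
          Polynomial.eval_prod, Polynomial.eval_sub, Polynomial.eval_X]
      refine Finset.sum_eq_single_of_mem i hi fun k hk hki => ?_
      rw [Finset.prod_eq_zero (i := i) (by simp [hi, hki.symm]) (by simp), mul_zero]
    rw [hW, Polynomial.eval_zero, eq_comm, mul_eq_zero, Finset.prod_eq_zero_iff] at hWi
    refine hWi.resolve_right ?_
    rintro ⟨j, hj, hij⟩
    exact (Finset.mem_erase.1 hj).1 (Subtype.ext (sub_eq_zero.1 hij).symm)
  have hcount : {l : ℂ | R < ‖l‖}.Countable := by
    have h1 := hli.cardinal_le_rank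
    have h2 : Module.rank ℂ (MvPolynomial ι ℂ) ≤ Cardinal.aleph0 := by
      rw [← (MvPolynomial.basisMonomials ι ℂ).mk_eq_rank'']
      exact Cardinal.mk_le_aleph0
    exact Cardinal.mk_le_aleph0_iff.1 (h1.trans h2)
  have hd := hcount.dense_compl ℂ
  have hc : IsClosed {l : ℂ | R < ‖l‖}ᶜ := by
    have : {l : ℂ | R < ‖l‖}ᶜ = {l : ℂ | ‖l‖ ≤ R} := by ext; simp
    rw [this]
    exact isClosed_le continuous_norm continuous_const
  have h1 : ((|R| + 1 : ℝ) : ℂ) ∈ {l : ℂ | R < ‖l‖}ᶜ := by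
    rw [← hc.closure_eq, hd.closure_eq]; trivial
  simp only [Set.mem_compl_iff, Set.mem_ofPred_eq, Complex.norm_real, Real.norm_eq_abs, not_lt] at h1
  have := le_abs_self (|R| + 1)
  have := le_abs_self R
  linarith

theorem Set.infinite_image_of_isPreconnected {X : Type*} [TopologicalSpace X] {s : Set X}
    (hs : IsPreconnected s) {f : X → ℂ} (hf : ContinuousOn f s)
    {x y : X} (hx : x ∈ s) (hy : y ∈ s) (hxy : f x ≠ f y) : (f '' s).Infinite := by
  exact (hs.image f hf).infinite_of_nontrivial ⟨f x, ⟨x, hx, rfl⟩, f y, ⟨y, hy, rfl⟩, hxy⟩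

theorem exists_rescaled_tendsto_of_ne_zero {E : Type*} [NormedAddCommGroup E] [NormedSpace ℂ E]
    [FiniteDimensional ℂ E] {J : Type*} (U : Ultrafilter J) (l : J → E →L[ℂ] ℂ)
    (hl : ∀ j, l j ≠ 0) :
    ∃ (s : J → ℝ) (η : E →L[ℂ] ℂ), (∀ j, 0 < s j) ∧ η ≠ 0 ∧
      ∃ e : J → ℝ, Tendsto e U (𝓝 0) ∧ ∀ j u, ‖(s j : ℂ) * l j u - η u‖ ≤ e j * ‖u‖ := by
  have : ProperSpace (E →L[ℂ] ℂ) := FiniteDimensional.proper ℂ _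
  set t : J → E →L[ℂ] ℂ := fun j => ((‖l j‖⁻¹ : ℝ) : ℂ) • l j
  have ht : ∀ j, t j ∈ Metric.sphere (0 : E →L[ℂ] ℂ) 1 := by
    intro j
    simp [t, norm_smul, hl j]
  obtain ⟨η, hη1, hη⟩ := (isCompact_sphere (0 : E →L[ℂ] ℂ) 1).ultrafilter_le_nhds (U.map t)
    (le_principal_iff.2 (Filter.mem_map.2 (univ_mem' ht)))
  refine ⟨fun j => ‖l j‖⁻¹, η, fun j => inv_pos.2 (norm_pos_iff.2 (hl j)), ?_,
    fun j => ‖t j - η‖, ?_, ?_⟩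
  · rintro rfl
    simp at hη1
  · have : Tendsto t U (𝓝 η) := hη
    exact tendsto_iff_norm_sub_tendsto_zero.1 this
  · intro j u
    simpa [t] using (t j - η).le_opNorm u

/-- Functionals that do not vanish identically on a set converge, after rescaling and along any
ultrafilter, to a functional with the same property, uniformly on bounded parts of its span. -/
theorem exists_rescaled_tendsto {E : Type*} [NormedAddCommGroup E] [NormedSpace ℂ E]
    [FiniteDimensional ℂ E] {J : Type*} (U : Ultrafilter J) (l : J → E →L[ℂ] ℂ) (T : Set E)
    (hl : ∀ j, ∃ u ∈ T, l j u ≠ 0) :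
    ∃ (s : J → ℝ) (η : E →L[ℂ] ℂ), (∀ j, 0 < s j) ∧ (∃ u ∈ T, η u ≠ 0) ∧
      ∃ e : J → ℝ, Tendsto e U (𝓝 0) ∧
        ∀ j, ∀ u ∈ Submodule.span ℂ T, ‖(s j : ℂ) * l j u - η u‖ ≤ e j * ‖u‖ := by
  obtain ⟨s, η, hs, hη0, e, he, hb⟩ := exists_rescaled_tendsto_of_ne_zero U
    (fun j => (l j).comp (Submodule.span ℂ T).subtypeL) fun j h => by
      obtain ⟨u, hu, hne⟩ := hl j
      exact hne (congrArg (fun f => f ⟨u, Submodule.subset_span hu⟩) h)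
  obtain ⟨g, hg⟩ := LinearMap.exists_extend (η : Submodule.span ℂ T →ₗ[ℂ] ℂ)
  have hgη : ∀ u : Submodule.span ℂ T, g u = η u := fun u => congrArg (fun f => f u) hg
  refine ⟨s, LinearMap.toContinuousLinearMap g, hs, ?_, e, he, ?_⟩
  · by_contra! hcon
    refine hη0 (ContinuousLinearMap.ext fun u => ?_)
    rw [← hgη]
    have hle : Submodule.span ℂ T ≤ LinearMap.ker g :=
      Submodule.span_le.2 fun u hu => hcon u hu
    exact hle u.2
  · intro j u hu
    have h2 : g u = η ⟨u, hu⟩ := hgη ⟨u, hu⟩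
    rw [LinearMap.coe_toContinuousLinearMap', h2]
    exact hb j ⟨u, hu⟩

theorem tendsto_of_norm_sub_le {E : Type*} [NormedAddCommGroup E] [NormedSpace ℂ E]
    {J : Type*} {l : Filter J} {f : J → ℂ} {a : ℂ} {e : J → ℝ} (he : Tendsto e l (𝓝 0)) {u : E}
    (h : ∀ j, ‖f j - a‖ ≤ e j * ‖u‖) : Tendsto f l (𝓝 a) := by
  rw [tendsto_iff_norm_sub_tendsto_zero]
  exact squeeze_zero (fun _ => norm_nonneg _) h (by simpa using he.mul_const ‖u‖)

theorem deriv_mem_span_image {E : Type*} [NormedAddCommGroup E] [NormedSpace ℂ E]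
    [FiniteDimensional ℂ E] {D : Set ℂ} (hD : IsOpen D) {f : ℂ → E} {w : ℂ} (hw : w ∈ D) :
    deriv f w ∈ Submodule.span ℂ (f '' D) := by
  have h := range_derivWithin_subset_closure_span_image f (s := D) (t := D)
    (by simpa using subset_closure) ⟨w, rfl⟩
  rwa [derivWithin_of_isOpen hD hw,
    (Submodule.closed_of_finiteDimensional (Submodule.span ℂ (f '' D))).closure_eq] at h

theorem eventually_ne_zero_of_ne {D : Set ℂ} (hD : IsOpen D) (hDc : IsPreconnected D) {f : ℂ → ℂ}
    (hf : DifferentiableOn ℂ f D) {x : ℂ} (hx : x ∈ D) (hfx : f x ≠ 0) {w : ℂ} (hw : w ∈ D) :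
    ∀ᶠ z in 𝓝[≠] w, f z ≠ 0 := by
  by_contra h
  exact hfx ((hf.analyticOnNhd hD).eqOn_zero_of_preconnected_of_frequently_eq_zero hDc hw
    (by rw [Filter.Frequently]; exact h) hx)

/-- Logarithmic derivatives stay bounded along normalized families of functionals of a fixed curve,
so they cannot balance linear terms that grow without bound. -/
theorem false_of_logDeriv_relation_of_unbounded {E₁ E₂ E₃ : Type*}
    [NormedAddCommGroup E₁] [NormedSpace ℂ E₁] [FiniteDimensional ℂ E₁]
    [NormedAddCommGroup E₂] [NormedSpace ℂ E₂] [FiniteDimensional ℂ E₂]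
    [NormedAddCommGroup E₃] [NormedSpace ℂ E₃] [FiniteDimensional ℂ E₃]
    {D : Set ℂ} (hD : IsOpen D) (hDc : IsPreconnected D)
    {f : ℂ → E₁} {g : ℂ → E₂} {h : ℂ → E₃} {H : ℂ → ℂ} {β c : ℂ}
    (hf : DifferentiableOn ℂ f D) (hg : DifferentiableOn ℂ g D) (hh : DifferentiableOn ℂ h D)
    (x : ℕ → E₁ →L[ℂ] ℂ) (y : ℕ → E₂ →L[ℂ] ℂ) (t : ℕ → E₃ →L[ℂ] ℂ)
    (hrel : ∀ j, ∀ w ∈ D, (x j (f w) - H w) * y j (g w) * t j (h w)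
      + β * y j (deriv g w) * t j (h w) + c * t j (deriv h w) * y j (g w) = 0)
    {z₀ w₁ : ℂ} (hz₀ : z₀ ∈ D) (hw₁ : w₁ ∈ D)
    (hy : ∀ j, y j (g z₀) = 1) (ht : ∀ j, t j (h z₀) = 1)
    (hx : ∀ j : ℕ, (j : ℝ) < ‖x j (f w₁)‖) : False := by
  set U : Ultrafilter ℕ := hyperfilter ℕ
  obtain ⟨s₁, η₁, hs₁, ⟨_, ⟨a₁, ha₁, rfl⟩, hη₁⟩, e₁, he₁, hb₁⟩ :=
    exists_rescaled_tendsto U x (f '' D) fun j => ⟨_, ⟨w₁, hw₁, rfl⟩, by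
      rw [← norm_pos_iff]; exact lt_of_le_of_lt (Nat.cast_nonneg j) (hx j)⟩
  obtain ⟨s₂, η₂, hs₂, ⟨_, ⟨a₂, ha₂, rfl⟩, hη₂⟩, e₂, he₂, hb₂⟩ :=
    exists_rescaled_tendsto U y (g '' D) fun j => ⟨_, ⟨z₀, hz₀, rfl⟩, by simp [hy]⟩
  obtain ⟨s₃, η₃, hs₃, ⟨_, ⟨a₃, ha₃, rfl⟩, hη₃⟩, e₃, he₃, hb₃⟩ :=
    exists_rescaled_tendsto U t (h '' D) fun j => ⟨_, ⟨z₀, hz₀, rfl⟩, by simp [ht]⟩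
  have hs₁0 : Tendsto (fun j => (s₁ j : ℂ)) U (𝓝 0) := by
    have h1 := (tendsto_of_norm_sub_le he₁ fun j =>
      hb₁ j (f w₁) (Submodule.subset_span ⟨w₁, hw₁, rfl⟩)).norm
    have h2 : Tendsto (fun j => ‖x j (f w₁)‖) U atTop :=
      (tendsto_atTop_mono (fun j => (hx j).le) tendsto_natCast_atTop_atTop).mono_left
        Nat.hyperfilter_le_atTop
    rw [tendsto_zero_iff_norm_tendsto_zero]
    refine (h1.div_atTop h2).congr fun j => ?_
    have : ‖x j (f w₁)‖ ≠ 0 := (lt_of_le_of_lt (Nat.cast_nonneg j) (hx j)).ne'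
    rw [norm_mul]; field_simp
  obtain ⟨w, ⟨hw1, hw2, hw3⟩, hwD⟩ := (((eventually_ne_zero_of_ne hD hDc
      (η₁.differentiable.comp_differentiableOn hf) ha₁ hη₁ hz₀).and
    ((eventually_ne_zero_of_ne hD hDc
      (η₂.differentiable.comp_differentiableOn hg) ha₂ hη₂ hz₀).and
    (eventually_ne_zero_of_ne hD hDc
      (η₃.differentiable.comp_differentiableOn hh) ha₃ hη₃ hz₀))).and
    (nhdsWithin_le_nhds (hD.mem_nhds hz₀))).exists
  have L1 := tendsto_of_norm_sub_le he₁ fun j =>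
    hb₁ j (f w) (Submodule.subset_span ⟨w, hwD, rfl⟩)
  have L2 := tendsto_of_norm_sub_le he₂ fun j =>
    hb₂ j (g w) (Submodule.subset_span ⟨w, hwD, rfl⟩)
  have L3 := tendsto_of_norm_sub_le he₃ fun j =>
    hb₃ j (h w) (Submodule.subset_span ⟨w, hwD, rfl⟩)
  have L2' := tendsto_of_norm_sub_le he₂ fun j => hb₂ j _ (deriv_mem_span_image hD hwD)
  have L3' := tendsto_of_norm_sub_le he₃ fun j => hb₃ j _ (deriv_mem_span_image hD hwD)
  have key := ((((L1.sub (hs₁0.mul_const (H w))).mul L2).mul L3).add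
    (((hs₁0.mul_const β).mul L2').mul L3)).add (((hs₁0.mul_const c).mul L3').mul L2)
  have h0 := tendsto_nhds_unique (key.congr fun j => ?_) (tendsto_const_nhds (x := (0 : ℂ)))
  · simp at h0
    rcases h0 with (h0 | h0) | h0
    exacts [hw1 h0, hw2 h0, hw3 h0]
  · linear_combination (s₁ j * s₂ j * s₃ j : ℂ) * hrel j w hwD

/-- Normalized functionals of a holomorphic curve that are unbounded at one point must vanish
somewhere along the curve. -/
theorem exists_zero_of_unbounded {E : Type*} [NormedAddCommGroup E] [NormedSpace ℂ E]
    [FiniteDimensional ℂ E] {D : Set ℂ} (hD : IsOpen D) (hDc : IsPreconnected D)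
    {g : ℂ → E} (hg : DifferentiableOn ℂ g D) (y : ℕ → E →L[ℂ] ℂ)
    {z₀ w₁ : ℂ} (hz₀ : z₀ ∈ D) (hw₁ : w₁ ∈ D) (hy : ∀ j, y j (g z₀) = 1)
    (hunb : ∀ j : ℕ, (j : ℝ) < ‖y j (g w₁)‖) : ∃ j, ∃ w ∈ D, y j (g w) = 0 := by
  by_contra! hcon
  set U : Ultrafilter ℕ := hyperfilter ℕ
  obtain ⟨s, η, hs, ⟨_, ⟨a, ha, rfl⟩, hη⟩, e, he, hb⟩ :=
    exists_rescaled_tendsto U y (g '' D) fun j => ⟨_, ⟨z₀, hz₀, rfl⟩, by simp [hy]⟩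
  have hs0 : Tendsto s U (𝓝 0) := by
    have h1 := (tendsto_of_norm_sub_le he fun j =>
      hb j (g w₁) (Submodule.subset_span ⟨w₁, hw₁, rfl⟩)).norm
    have h2 : Tendsto (fun j => ‖y j (g w₁)‖) U atTop :=
      (tendsto_atTop_mono (fun j => (hunb j).le) tendsto_natCast_atTop_atTop).mono_left
        Nat.hyperfilter_le_atTop
    refine (h1.div_atTop h2).congr fun j => ?_
    have : ‖y j (g w₁)‖ ≠ 0 := (lt_of_le_of_lt (Nat.cast_nonneg j) (hunb j)).ne'
    rw [norm_mul, Complex.norm_real, Real.norm_of_nonneg (hs j).le]; field_simp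
  have hηd := η.differentiable.comp_differentiableOn hg
  have hev := eventually_ne_zero_of_ne hD hDc hηd ha hη hz₀
  rw [eventually_nhdsWithin_iff] at hev
  obtain ⟨r, hr, hrD⟩ := Metric.eventually_nhds_iff_ball.1 (hev.and (hD.mem_nhds hz₀))
  set ρ := r / 2
  have hρ : 0 < ρ := half_pos hr
  have hρr : ρ < r := half_lt_self hr
  have hball : Metric.closedBall z₀ ρ ⊆ D := fun z hz =>
    (hrD z (Metric.closedBall_subset_ball hρr hz)).2
  have hsphD : Metric.sphere z₀ ρ ⊆ D := Metric.sphere_subset_closedBall.trans hball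
  have hsne : (Metric.sphere z₀ ρ).Nonempty := NormedSpace.sphere_nonempty.2 hρ.le
  obtain ⟨m, hmS, hm⟩ := (isCompact_sphere z₀ ρ).exists_isMinOn hsne
    ((hηd.continuousOn.mono hsphD).norm)
  obtain ⟨M, hM⟩ := (isCompact_sphere z₀ ρ).exists_bound_of_continuousOn
    (hg.continuousOn.mono hsphD)
  set δ := ‖η (g m)‖
  have hδ : 0 < δ := by
    refine norm_pos_iff.2 ((hrD m ?_).1 ?_)
    · exact Metric.closedBall_subset_ball hρr (Metric.sphere_subset_closedBall hmS)
    · rintro rfl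
      simp at hmS
      exact hρ.ne hmS
  have hM0 : 0 ≤ M := (norm_nonneg _).trans (hM m hmS)
  obtain ⟨j, hj1, hj2⟩ := ((he.eventually (gt_mem_nhds (show 0 < δ / 2 / (M + 1) by positivity))).and
    (hs0.eventually (gt_mem_nhds (show 0 < δ / 2 by positivity)))).exists
  have hsj : (s j : ℂ) ≠ 0 := by exact_mod_cast (hs j).ne'
  have hlow : ∀ z ∈ Metric.sphere z₀ ρ, δ / 2 ≤ ‖(s j : ℂ) * y j (g z)‖ := by
    intro z hz
    have h1 := hb j (g z) (Submodule.subset_span ⟨z, hsphD hz, rfl⟩)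
    have h2 : δ ≤ ‖η (g z)‖ := hm hz
    have h3 : e j * ‖g z‖ ≤ δ / 2 := by
      rw [lt_div_iff₀ (by positivity)] at hj1
      have := hM z hz
      rcases le_or_gt (e j) 0 with h | h
      · nlinarith [norm_nonneg (g z)]
      · nlinarith [norm_nonneg (g z)]
    have h4 := norm_sub_norm_le (η (g z)) ((s j : ℂ) * y j (g z))
    rw [norm_sub_rev] at h4
    linarith
  have hdiff : DifferentiableOn ℂ (fun z => ((s j : ℂ) * y j (g z))⁻¹) D :=
    (((y j).differentiable.comp_differentiableOn hg).const_mul _).inv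
      fun z hz => mul_ne_zero hsj (hcon j z hz)
  have hdc : DiffContOnCl ℂ (fun z => ((s j : ℂ) * y j (g z))⁻¹) (Metric.ball z₀ ρ) := by
    refine (hdiff.mono ?_).diffContOnCl
    rwa [closure_ball _ hρ.ne']
  have hmax := Complex.norm_le_of_forall_mem_frontier_norm_le Metric.isBounded_ball hdc
    (C := (δ / 2)⁻¹) (fun z hz => by
      rw [frontier_ball _ hρ.ne'] at hz
      rw [norm_inv]
      exact inv_anti₀ (by positivity) (hlow z hz)) (subset_closure (Metric.mem_ball_self hρ))
  rw [hy, mul_one, norm_inv, Complex.norm_real, Real.norm_of_nonneg (hs j).le,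
    inv_le_inv₀ (hs j) (by positivity)] at hmax
  linarith

theorem false_of_zero_of_logDeriv_relation {D : Set ℂ} (hD : IsOpen D) (hDc : IsPreconnected D)
    {P Q M : ℂ → ℂ} {β c : ℝ}
    (hP : DifferentiableOn ℂ P D) (hQ : DifferentiableOn ℂ Q D) (hM : ContinuousOn M D)
    (hrel : ∀ w ∈ D, M w * P w * Q w + β * deriv P w * Q w + c * deriv Q w * P w = 0)
    {z₀ w : ℂ} (hz₀ : z₀ ∈ D) (hw : w ∈ D) (hP₀ : P z₀ = 1) (hQ₀ : Q z₀ = 1)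
    (hPw : P w = 0) (hβc : 0 < β * c) : False := by
  have order : ∀ f : ℂ → ℂ, DifferentiableOn ℂ f D → f z₀ = 1 → ∃ (p : ℕ) (f₁ : ℂ → ℂ),
      AnalyticAt ℂ f₁ w ∧ f₁ w ≠ 0 ∧ ∀ᶠ z in 𝓝 w, f z = (z - w) ^ p * f₁ z := by
    intro f hf hf0
    have han := hf.analyticOnNhd hD w hw
    have hne : analyticOrderAt f w ≠ ⊤ := by
      intro htop
      rw [analyticOrderAt_eq_top] at htop
      have := eventually_ne_zero_of_ne hD hDc hf hz₀ (by simp [hf0]) hw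
      obtain ⟨z, h1, h2⟩ := (this.and (nhdsWithin_le_nhds htop)).exists
      exact h1 h2
    obtain ⟨f₁, h1, h2, h3⟩ := han.analyticOrderAt_ne_top.1 hne
    exact ⟨_, f₁, h1, h2, h3⟩
  obtain ⟨p, P₁, hP₁, hP₁w, hPP⟩ := order P hP hP₀
  obtain ⟨q, Q₁, hQ₁, hQ₁w, hQQ⟩ := order Q hQ hQ₀
  have hp : p ≠ 0 := by
    rintro rfl
    have := hPP.self_of_nhds
    rw [hPw, pow_zero, one_mul] at this
    exact hP₁w this.symm
  have hder : ∀ {f f₁ : ℂ → ℂ} {p : ℕ}, AnalyticAt ℂ f₁ w →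
      (∀ᶠ z in 𝓝 w, f z = (z - w) ^ p * f₁ z) →
      ∀ᶠ z in 𝓝 w, (z - w) * deriv f z = (z - w) ^ p * (p * f₁ z + (z - w) * deriv f₁ z) := by
    intro f f₁ p hf₁ hff
    filter_upwards [hff.eventually_nhds, hf₁.eventually_analyticAt] with z hz hz1
    have h1 : HasDerivAt (fun z => (z - w) ^ p * f₁ z) _ z :=
      (((hasDerivAt_id z).sub_const w).pow p).mul hz1.differentiableAt.hasDerivAt
    rw [Filter.EventuallyEq.deriv_eq hz, h1.deriv]
    rcases p with _ | p
    · simp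
    · simp; ring
  have hlim : ∀ᶠ z in 𝓝[≠] w, (z - w) * M z * P₁ z * Q₁ z
      + β * (p * P₁ z + (z - w) * deriv P₁ z) * Q₁ z
      + c * (q * Q₁ z + (z - w) * deriv Q₁ z) * P₁ z = 0 := by
    filter_upwards [nhdsWithin_le_nhds hPP, nhdsWithin_le_nhds hQQ,
      nhdsWithin_le_nhds (hder hP₁ hPP), nhdsWithin_le_nhds (hder hQ₁ hQQ),
      nhdsWithin_le_nhds (hD.mem_nhds hw), self_mem_nhdsWithin] with z h1 h2 h3 h4 h5 h6
    have hzw : (z - w) ^ p * (z - w) ^ q ≠ 0 :=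
      mul_ne_zero (pow_ne_zero _ (sub_ne_zero.2 h6)) (pow_ne_zero _ (sub_ne_zero.2 h6))
    refine (mul_eq_zero.1 ?_).resolve_left hzw
    have := hrel z h5
    rw [h1, h2] at this
    linear_combination (z - w) * this - β * (z - w) ^ q * Q₁ z * h3 - c * (z - w) ^ p * P₁ z * h4
  have hcont : ContinuousAt (fun z => (z - w) * M z * P₁ z * Q₁ z
      + β * (p * P₁ z + (z - w) * deriv P₁ z) * Q₁ z
      + c * (q * Q₁ z + (z - w) * deriv Q₁ z) * P₁ z) w := by
    have := hM.continuousAt (hD.mem_nhds hw)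
    have := hP₁.continuousAt
    have := hQ₁.continuousAt
    have := hP₁.deriv.continuousAt
    have := hQ₁.deriv.continuousAt
    fun_prop
  have h0 := tendsto_nhds_unique ((hcont.tendsto.mono_left nhdsWithin_le_nhds).congr' hlim)
    (tendsto_const_nhds (x := (0 : ℂ)))
  have h1 : ((β * p + c * q : ℝ) : ℂ) * (P₁ w * Q₁ w) = 0 := by
    push_cast
    simp at h0
    linear_combination h0
  have h2 : β * p + c * q = 0 := by
    exact_mod_cast (mul_eq_zero.1 h1).resolve_right (mul_ne_zero hP₁w hQ₁w)
  have hp' : (1 : ℝ) ≤ p := by exact_mod_cast Nat.one_le_iff_ne_zero.2 hp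
  have hq' : (0 : ℝ) ≤ q := Nat.cast_nonneg q
  have h3 : β ^ 2 * p + β * c * q = 0 := by linear_combination β * h2
  have h4 : 0 < β ^ 2 := by
    have : β ≠ 0 := by rintro rfl; simp at hβc
    positivity
  nlinarith [mul_nonneg hβc.le hq']

theorem iteratedFDeriv_two_apply_eq_of_hasDerivAt {u : ℂ → ℝ} {z v : ℂ} (hu : ContDiffAt ℝ 2 u z)
    {d : ℝ → ℝ} {e : ℝ}
    (hd : ∀ᶠ t in 𝓝 (0 : ℝ), HasDerivAt (fun t : ℝ => u (z + t * v)) (d t) t)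
    (he : HasDerivAt d e 0) : iteratedFDeriv ℝ 2 u z ![v, v] = e := by
  have hline : ∀ t : ℝ, HasDerivAt (fun t : ℝ => z + t * v) v t := fun t => by
    simpa using ((hasDerivAt_id t).ofReal_comp.mul_const v).const_add z
  have h1 : DifferentiableAt ℝ (fderiv ℝ u) z :=
    (hu.fderiv_right (m := 1) (by norm_num)).differentiableAt (by norm_num)
  have h2 : HasDerivAt (fun t : ℝ => fderiv ℝ u (z + t * v) v) (fderiv ℝ (fderiv ℝ u) z v v) 0 := by
    have h3 : HasFDerivAt (fderiv ℝ u) (fderiv ℝ (fderiv ℝ u) z) (z + (0 : ℝ) * v) := by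
      simpa using h1.hasFDerivAt
    have h4 : HasFDerivAt (fun w => fderiv ℝ u w v) ((fderiv ℝ (fderiv ℝ u) z).flip v)
        (z + (0 : ℝ) * v) := by
      simpa using h3.clm_apply (hasFDerivAt_const v _)
    exact h4.comp_hasDerivAt (0 : ℝ) (hline 0)
  have h4 : ∀ᶠ t : ℝ in 𝓝 (0 : ℝ), ContDiffAt ℝ 2 u (z + t * v) := by
    have hc : Tendsto (fun t : ℝ => z + t * v) (𝓝 0) (𝓝 z) := by
      simpa using (hline 0).continuousAt.tendsto
    exact hc.eventually (hu.eventually (by simp))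
  have h5 : d =ᶠ[𝓝 0] fun t : ℝ => fderiv ℝ u (z + t * v) v := by
    filter_upwards [hd, h4] with t h6 h7
    exact h6.unique ((h7.differentiableAt (by norm_num)).hasFDerivAt.comp_hasDerivAt t (hline t))
  rw [iteratedFDeriv_two_apply]
  simpa using h2.unique (he.congr_of_eventuallyEq h5.symm)

theorem hasDerivAt_along_line {E : Type*} [NormedAddCommGroup E] [NormedSpace ℂ E]
    {D : Set ℂ} (hD : IsOpen D) {f : ℂ → E}
    (hf : DifferentiableOn ℂ f D) {z v : ℂ} {t : ℝ} (h : z + t * v ∈ D) :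
    HasDerivAt (fun t : ℝ => f (z + t * v)) (v • deriv f (z + t * v)) t := by
  have hline : HasDerivAt (fun t : ℝ => z + t * v) v t := by
    simpa using ((hasDerivAt_id t).ofReal_comp.mul_const v).const_add z
  exact (hf.differentiableAt (hD.mem_nhds h)).hasDerivAt.scomp t hline

/-- The first two derivatives of `‖f‖ ^ 2` along a real line. -/
theorem hasDerivAt_norm_sq_along_line {E : Type*} [NormedAddCommGroup E] [InnerProductSpace ℂ E]
    [CompleteSpace E] {D : Set ℂ} (hD : IsOpen D) {f : ℂ → E}
    (hf : DifferentiableOn ℂ f D) {z : ℂ} (v : ℂ) :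
    (∀ t : ℝ, z + t * v ∈ D → HasDerivAt (fun t : ℝ => ‖f (z + t * v)‖ ^ 2)
      (2 * (v * inner ℂ (f (z + t * v)) (deriv f (z + t * v))).re) t) ∧
    (z ∈ D → HasDerivAt (fun t : ℝ =>
        2 * (v * inner ℂ (f (z + t * v)) (deriv f (z + t * v))).re)
      (2 * (‖v‖ ^ 2 * ‖deriv f z‖ ^ 2 + (v ^ 2 * inner ℂ (f z) (deriv (deriv f) z)).re)) 0) := by
  constructor
  · intro t ht
    have h1 := hasDerivAt_along_line hD hf ht
    have h2 := (Complex.reCLM.hasFDerivAt.comp_hasDerivAt t (h1.inner ℂ h1))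
    have h3 : (fun t : ℝ => ‖f (z + t * v)‖ ^ 2) =
        (Complex.reCLM ∘ fun t : ℝ => inner ℂ (f (z + t * v)) (f (z + t * v))) := by
      ext t
      simp [← inner_self_eq_norm_sq (𝕜 := ℂ)]
    rw [h3]
    refine h2.congr_deriv ?_
    have h4 := inner_re_symm (𝕜 := ℂ) (v • deriv f (z + t * v)) (f (z + t * v))
    simp only [RCLike.re_eq_complex_re] at h4
    rw [map_add, Complex.reCLM_apply, Complex.reCLM_apply, h4, inner_smul_right]
    ring
  · intro hz
    have hz' : z + ((0 : ℝ) : ℂ) * v ∈ D := by simpa using hz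
    have h1 := hasDerivAt_along_line hD hf hz'
    have h2 := hasDerivAt_along_line hD (hf.deriv hD) hz'
    have h3 := (Complex.reCLM.hasFDerivAt.comp_hasDerivAt (0 : ℝ)
      ((h1.inner ℂ h2).const_mul v)).const_mul 2
    refine h3.congr_deriv ?_
    simp only [Complex.ofReal_zero, zero_mul, add_zero, inner_smul_right, inner_smul_left,
      inner_self_eq_norm_sq_to_K, Complex.reCLM_apply]
    have : v * (v * inner ℂ (f z) (deriv (deriv f) z) +
        (starRingEnd ℂ) v * ((‖deriv f z‖ : ℝ) : ℂ) ^ 2) =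
        ((‖v‖ ^ 2 * ‖deriv f z‖ ^ 2 : ℝ) : ℂ) + v ^ 2 * inner ℂ (f z) (deriv (deriv f) z) := by
      push_cast
      rw [← Complex.mul_conj']
      ring
    erw [this]
    simp only [Complex.add_re, Complex.ofReal_re]

theorem laplacian_potential_eq {E₁ E₂ E₃ : Type*}
    [NormedAddCommGroup E₁] [InnerProductSpace ℂ E₁] [CompleteSpace E₁]
    [NormedAddCommGroup E₂] [InnerProductSpace ℂ E₂] [CompleteSpace E₂]
    [NormedAddCommGroup E₃] [InnerProductSpace ℂ E₃] [CompleteSpace E₃]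
    {D : Set ℂ} (hD : IsOpen D) {F : ℂ → E₁} {G : ℂ → E₂} {L : ℂ → E₃}
    (hF : DifferentiableOn ℂ F D) (hG : DifferentiableOn ℂ G D) (hL : DifferentiableOn ℂ L D)
    (hball : ∀ z ∈ D, ‖G z‖ < 1) {a b c : ℝ}
    (hu : HarmonicOn (fun z => a * ‖F z‖ ^ 2 - b * Real.log (1 - ‖G z‖ ^ 2)
      + c * Real.log (1 + ‖L z‖ ^ 2)) D) {z : ℂ} (hz : z ∈ D) :
    a * ‖deriv F z‖ ^ 2
      + b * ((‖deriv G z‖ ^ 2 * (1 - ‖G z‖ ^ 2) + ‖inner ℂ (G z) (deriv G z)‖ ^ 2)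
        / (1 - ‖G z‖ ^ 2) ^ 2)
      + c * ((‖deriv L z‖ ^ 2 * (1 + ‖L z‖ ^ 2) - ‖inner ℂ (L z) (deriv L z)‖ ^ 2)
        / (1 + ‖L z‖ ^ 2) ^ 2) = 0 := by
  obtain ⟨hu2, hu0⟩ := hu
  set u : ℂ → ℝ := fun z => a * ‖F z‖ ^ 2 - b * Real.log (1 - ‖G z‖ ^ 2)
      + c * Real.log (1 + ‖L z‖ ^ 2) with hu_def
  have hGpos : ∀ w ∈ D, 1 - ‖G w‖ ^ 2 ≠ 0 := fun w hw => by
    nlinarith [hball w hw, norm_nonneg (G w)]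
  have hLpos : ∀ w, 1 + ‖L w‖ ^ 2 ≠ 0 := fun w => by positivity
  have second : ∀ v : ℂ, iteratedFDeriv ℝ 2 u z ![v, v] =
      a * (2 * (‖v‖ ^ 2 * ‖deriv F z‖ ^ 2 + (v ^ 2 * inner ℂ (F z) (deriv (deriv F) z)).re))
      + b * ((2 * (‖v‖ ^ 2 * ‖deriv G z‖ ^ 2 + (v ^ 2 * inner ℂ (G z) (deriv (deriv G) z)).re)
          * (1 - ‖G z‖ ^ 2) + (2 * (v * inner ℂ (G z) (deriv G z)).re) ^ 2) / (1 - ‖G z‖ ^ 2) ^ 2)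
      + c * ((2 * (‖v‖ ^ 2 * ‖deriv L z‖ ^ 2 + (v ^ 2 * inner ℂ (L z) (deriv (deriv L) z)).re)
          * (1 + ‖L z‖ ^ 2) - (2 * (v * inner ℂ (L z) (deriv L z)).re) ^ 2)
            / (1 + ‖L z‖ ^ 2) ^ 2) := by
    intro v
    obtain ⟨hF1, hF2⟩ := hasDerivAt_norm_sq_along_line hD hF (z := z) v
    obtain ⟨hG1, hG2⟩ := hasDerivAt_norm_sq_along_line hD hG (z := z) v
    obtain ⟨hL1, hL2⟩ := hasDerivAt_norm_sq_along_line hD hL (z := z) v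
    have hev : ∀ᶠ t : ℝ in 𝓝 0, z + t * v ∈ D := by
      have hc : Tendsto (fun t : ℝ => z + t * v) (𝓝 0) (𝓝 z) := by
        have : Continuous fun t : ℝ => z + t * v := by fun_prop
        simpa using this.tendsto 0
      exact hc.eventually (hD.mem_nhds hz)
    have hz' : z + ((0 : ℝ) : ℂ) * v = z := by simp
    have hzD : z + ((0 : ℝ) : ℂ) * v ∈ D := by rwa [hz']
    refine iteratedFDeriv_two_apply_eq_of_hasDerivAt (hu2.contDiffAt (hD.mem_nhds hz))
      (d := fun t : ℝ => a * (2 * (v * inner ℂ (F (z + t * v)) (deriv F (z + t * v))).re)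
        - b * (-(2 * (v * inner ℂ (G (z + t * v)) (deriv G (z + t * v))).re)
            / (1 - ‖G (z + t * v)‖ ^ 2))
        + c * (2 * (v * inner ℂ (L (z + t * v)) (deriv L (z + t * v))).re
            / (1 + ‖L (z + t * v)‖ ^ 2))) ?_ ?_
    · filter_upwards [hev] with t ht
      exact (((hF1 t ht).const_mul a).sub
        ((((hG1 t ht).const_sub 1).log (hGpos _ ht)).const_mul b)).add
        ((((hL1 t ht).const_add 1).log (hLpos _)).const_mul c)
    · have := (((hF2 hz).const_mul a).sub
        (((hG2 hz).neg.div ((hG1 0 hzD).const_sub 1) (hGpos _ hzD)).const_mul b)).add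
        (((hL2 hz).div ((hL1 0 hzD).const_add 1) (hLpos _)).const_mul c)
      refine this.congr_deriv ?_
      simp only [Pi.neg_apply, hz']
      ring
  have h0 := hu0 z hz
  rw [complexLaplacian, second, second] at h0
  have hsq : ∀ w : ℂ, ‖w‖ ^ 2 = w.re ^ 2 + w.im ^ 2 := fun w => by
    rw [Complex.sq_norm, Complex.normSq_apply]; ring
  rw [hsq (inner ℂ (G z) (deriv G z)), hsq (inner ℂ (L z) (deriv L z))]
  simp only [norm_one, Complex.norm_I, one_pow, one_mul, Complex.I_sq, neg_mul, Complex.neg_re,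
    Complex.I_mul_re] at h0
  linear_combination h0 / 4

theorem sum_conj_mul_deriv_eq_zero {κ : Type*} [Fintype κ] {D : Set ℂ} (hD : IsOpen D)
    {p q : κ → ℂ → ℂ} (hp : ∀ i, DifferentiableOn ℂ (p i) D)
    (hq : ∀ i, DifferentiableOn ℂ (q i) D)
    (h : ∀ z ∈ D, ∑ i, starRingEnd ℂ (p i z) * q i z = 0) :
    ∀ z ∈ D, ∑ i, starRingEnd ℂ (p i z) * deriv (q i) z = 0 := by
  intro z hz
  have key : ∀ v : ℂ, ∑ i, (starRingEnd ℂ (v * deriv (p i) z) * q i z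
      + starRingEnd ℂ (p i z) * (v * deriv (q i) z)) = 0 := by
    intro v
    have hline : HasDerivAt (fun t : ℝ => z + t * v) v 0 := by
      simpa using ((hasDerivAt_id (0 : ℝ)).ofReal_comp.mul_const v).const_add z
    have hdir : ∀ f : ℂ → ℂ, DifferentiableOn ℂ f D →
        HasDerivAt (fun t : ℝ => f (z + t * v)) (v * deriv f z) 0 := fun f hf => by
      have h1 : HasDerivAt f (deriv f z) (z + (0 : ℝ) * v) := by
        simpa using (hf.differentiableAt (hD.mem_nhds hz)).hasDerivAt
      exact h1.scomp (0 : ℝ) hline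
    have h1 : HasDerivAt (fun t : ℝ => ∑ i, starRingEnd ℂ (p i (z + t * v)) * q i (z + t * v))
        (∑ i, (starRingEnd ℂ (v * deriv (p i) z) * q i z
          + starRingEnd ℂ (p i z) * (v * deriv (q i) z))) 0 := by
      refine HasDerivAt.fun_sum fun i _ => ?_
      refine ((hdir (p i) (hp i)).star.mul (hdir (q i) (hq i))).congr_deriv ?_
      simp
    have h2 : (fun t : ℝ => ∑ i, starRingEnd ℂ (p i (z + t * v)) * q i (z + t * v))
        =ᶠ[𝓝 0] fun _ => 0 := by
      have hc : Tendsto (fun t : ℝ => z + t * v) (𝓝 0) (𝓝 z) := by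
        simpa using hline.continuousAt.tendsto
      exact (hc.eventually (hD.mem_nhds hz)).mono fun t ht => h _ ht
    exact h1.unique ((hasDerivAt_const (0 : ℝ) (0 : ℂ)).congr_of_eventuallyEq h2)
  have h1 := key 1
  have hI := key Complex.I
  simp only [map_mul, Complex.conj_I, one_mul, Finset.sum_add_distrib] at h1 hI
  have e1 : ∑ i, -Complex.I * starRingEnd ℂ (deriv (p i) z) * q i z
      = -Complex.I * ∑ i, starRingEnd ℂ (deriv (p i) z) * q i z := by
    rw [Finset.mul_sum]; exact Finset.sum_congr rfl fun i _ => by ring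
  have e2 : ∑ i, starRingEnd ℂ (p i z) * (Complex.I * deriv (q i) z)
      = Complex.I * ∑ i, starRingEnd ℂ (p i z) * deriv (q i) z := by
    rw [Finset.mul_sum]; exact Finset.sum_congr rfl fun i _ => by ring
  rw [e1, e2] at hI
  linear_combination (1 / 2 : ℂ) * h1 - Complex.I / 2 * hI
    - (1 / 2 : ℂ) * (∑ i, starRingEnd ℂ (deriv (p i) z) * q i z
      - ∑ i, starRingEnd ℂ (p i z) * deriv (q i) z) * Complex.I_sq

/-- Polarization: a finite sum of products of antiholomorphic and holomorphic functions that
vanishes on the diagonal vanishes identically. -/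
theorem sum_conj_mul_eq_zero_of_diagonal {κ : Type*} [Fintype κ] {D : Set ℂ} (hD : IsOpen D)
    (hDc : IsPreconnected D) {p q : κ → ℂ → ℂ} (hp : ∀ i, DifferentiableOn ℂ (p i) D)
    (hq : ∀ i, DifferentiableOn ℂ (q i) D)
    (h : ∀ z ∈ D, ∑ i, starRingEnd ℂ (p i z) * q i z = 0) :
    ∀ z ∈ D, ∀ w ∈ D, ∑ i, starRingEnd ℂ (p i z) * q i w = 0 := by
  intro z hz
  have iter : ∀ k : ℕ, (∀ i, DifferentiableOn ℂ (iteratedDeriv k (q i)) D) ∧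
      ∀ z ∈ D, ∑ i, starRingEnd ℂ (p i z) * iteratedDeriv k (q i) z = 0 := by
    intro k
    induction k with
    | zero => simpa using ⟨hq, h⟩
    | succ k ih =>
      simp only [iteratedDeriv_succ]
      exact ⟨fun i => (ih.1 i).deriv hD, sum_conj_mul_deriv_eq_zero hD hp ih.1 ih.2⟩
  set f : ℂ → ℂ := fun w => ∑ i, starRingEnd ℂ (p i z) * q i w
  have hf : DifferentiableOn ℂ f D := DifferentiableOn.fun_sum fun i _ => (hq i).const_mul _
  have hfa := hf.analyticOnNhd hD
  have hord : analyticOrderAt f z = ⊤ := by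
    rw [ENat.eq_top_iff_forall_ge]
    intro k
    rw [natCast_le_analyticOrderAt_iff_iteratedDeriv_eq_zero (hfa z hz)]
    intro j _
    have h1 : iteratedDeriv j f z = ∑ i, starRingEnd ℂ (p i z) * iteratedDeriv j (q i) z := by
      rw [iteratedDeriv_fun_sum fun i _ =>
        contDiffAt_const.mul ((hq i).analyticOnNhd hD z hz).contDiffAt]
      exact Finset.sum_congr rfl fun i _ => iteratedDeriv_const_mul_field _ _
    rw [h1, (iter j).2 z hz]
  exact fun w hw => hfa.eqOn_zero_of_preconnected_of_eventuallyEq_zero hDc hz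
    (analyticOrderAt_eq_top.1 hord) hw

/-- `S` is a finite sum of products `conj (p z) * q w` with `p` and `q` holomorphic on `D`. -/
def IsFiniteSesqui (D : Set ℂ) (S : ℂ → ℂ → ℂ) : Prop :=
  ∃ (κ : Type) (_ : Fintype κ) (p q : κ → ℂ → ℂ), (∀ i, DifferentiableOn ℂ (p i) D) ∧
    (∀ i, DifferentiableOn ℂ (q i) D) ∧ ∀ z w, S z w = ∑ i, starRingEnd ℂ (p i z) * q i w

namespace IsFiniteSesqui

variable {D : Set ℂ} {S T : ℂ → ℂ → ℂ}

theorem eq_zero_of_diagonal (hS : IsFiniteSesqui D S) (hD : IsOpen D) (hDc : IsPreconnected D)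
    (h : ∀ z ∈ D, S z z = 0) : ∀ z ∈ D, ∀ w ∈ D, S z w = 0 := by
  obtain ⟨κ, _, p, q, hp, hq, hSpq⟩ := hS
  simp only [hSpq] at h ⊢
  exact sum_conj_mul_eq_zero_of_diagonal hD hDc hp hq h

theorem const (D : Set ℂ) (a : ℂ) : IsFiniteSesqui D fun _ _ => a :=
  ⟨Unit, inferInstance, fun _ _ => 1, fun _ _ => a, fun _ => differentiableOn_const _,
    fun _ => differentiableOn_const _, by simp⟩

theorem add (hS : IsFiniteSesqui D S) (hT : IsFiniteSesqui D T) :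
    IsFiniteSesqui D fun z w => S z w + T z w := by
  obtain ⟨κ, _, p, q, hp, hq, hS⟩ := hS
  obtain ⟨μ, _, r, s, hr, hs, hT⟩ := hT
  refine ⟨κ ⊕ μ, inferInstance, Sum.elim p r, Sum.elim q s, ?_, ?_, by simp [hS, hT]⟩
  · rintro (i | i) <;> simp [hp, hr]
  · rintro (i | i) <;> simp [hq, hs]

theorem mul (hS : IsFiniteSesqui D S) (hT : IsFiniteSesqui D T) :
    IsFiniteSesqui D fun z w => S z w * T z w := by
  obtain ⟨κ, _, p, q, hp, hq, hS⟩ := hS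
  obtain ⟨μ, _, r, s, hr, hs, hT⟩ := hT
  refine ⟨κ × μ, inferInstance, fun i z => p i.1 z * r i.2 z, fun i z => q i.1 z * s i.2 z,
    fun i => (hp _).mul (hr _), fun i => (hq _).mul (hs _), fun z w => ?_⟩
  simp only [hS, hT, Finset.sum_mul_sum, Fintype.sum_prod_type, map_mul]
  exact Finset.sum_congr rfl fun i _ => Finset.sum_congr rfl fun j _ => by ring

theorem sub (hS : IsFiniteSesqui D S) (hT : IsFiniteSesqui D T) :
    IsFiniteSesqui D fun z w => S z w - T z w := by
  simpa [sub_eq_add_neg] using hS.add ((const D (-1)).mul hT)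

theorem inner {k : ℕ} {f g : ℂ → EuclideanSpace ℂ (Fin k)} (hf : DifferentiableOn ℂ f D)
    (hg : DifferentiableOn ℂ g D) : IsFiniteSesqui D fun z w => inner ℂ (f z) (g w) :=
  ⟨Fin k, inferInstance, fun i z => f z i, fun i z => g z i,
    fun i => differentiableOn_euclidean.1 hf i, fun i => differentiableOn_euclidean.1 hg i,
    fun z w => by simp [PiLp.inner_apply, mul_comm]⟩

end IsFiniteSesqui

theorem polarized_relation {n m N : ℕ} {D : Set ℂ} (hD : IsOpen D) (hDc : IsPreconnected D)
    {F : ℂ → EuclideanSpace ℂ (Fin n)} {G : ℂ → EuclideanSpace ℂ (Fin m)}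
    {L : ℂ → EuclideanSpace ℂ (Fin N)} (hF : DifferentiableOn ℂ F D)
    (hG : DifferentiableOn ℂ G D) (hL : DifferentiableOn ℂ L D)
    (hball : ∀ z ∈ D, ‖G z‖ < 1) {a b c : ℝ}
    (hdiag : ∀ z ∈ D, a * ‖deriv F z‖ ^ 2
      + b * ((‖deriv G z‖ ^ 2 * (1 - ‖G z‖ ^ 2) + ‖inner ℂ (G z) (deriv G z)‖ ^ 2)
        / (1 - ‖G z‖ ^ 2) ^ 2)
      + c * ((‖deriv L z‖ ^ 2 * (1 + ‖L z‖ ^ 2) - ‖inner ℂ (L z) (deriv L z)‖ ^ 2)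
        / (1 + ‖L z‖ ^ 2) ^ 2) = 0) :
    ∀ z ∈ D, ∀ w ∈ D, (a : ℂ) * inner ℂ (deriv F z) (deriv F w)
        * ((1 - inner ℂ (G z) (G w)) * (1 - inner ℂ (G z) (G w)))
        * ((1 + inner ℂ (L z) (L w)) * (1 + inner ℂ (L z) (L w)))
      + b * (inner ℂ (deriv G z) (deriv G w) * (1 - inner ℂ (G z) (G w))
          + inner ℂ (deriv G z) (G w) * inner ℂ (G z) (deriv G w))
        * ((1 + inner ℂ (L z) (L w)) * (1 + inner ℂ (L z) (L w)))
      + c * (inner ℂ (deriv L z) (deriv L w) * (1 + inner ℂ (L z) (L w))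
          - inner ℂ (deriv L z) (L w) * inner ℂ (L z) (deriv L w))
        * ((1 - inner ℂ (G z) (G w)) * (1 - inner ℂ (G z) (G w))) = 0 := by
  have hF' := hF.deriv hD
  have hG' := hG.deriv hD
  have hL' := hL.deriv hD
  have hP := (IsFiniteSesqui.const D 1).sub (.inner hG hG)
  have hQ := (IsFiniteSesqui.const D 1).add (.inner hL hL)
  refine IsFiniteSesqui.eq_zero_of_diagonal
    ((((((IsFiniteSesqui.const D a).mul (.inner hF' hF')).mul (hP.mul hP)).mul (hQ.mul hQ)).add
      (((IsFiniteSesqui.const D b).mul (((IsFiniteSesqui.inner hG' hG').mul hP).add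
        ((IsFiniteSesqui.inner hG' hG).mul (.inner hG hG')))).mul (hQ.mul hQ))).add
      (((IsFiniteSesqui.const D c).mul (((IsFiniteSesqui.inner hL' hL').mul hQ).sub
        ((IsFiniteSesqui.inner hL' hL).mul (.inner hL hL')))).mul (hP.mul hP))) hD hDc ?_
  intro z hz
  have h1 : (1 - ‖G z‖ ^ 2) ≠ 0 := by nlinarith [hball z hz, norm_nonneg (G z)]
  have h2 : (1 + ‖L z‖ ^ 2) ≠ 0 := by positivity
  have h3 := hdiag z hz
  field_simp at h3
  have h4 : ∀ {k : ℕ} (u v : EuclideanSpace ℂ (Fin k)),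
      inner ℂ u v * inner ℂ v u = ((‖inner ℂ v u‖ ^ 2 : ℝ) : ℂ) := fun u v => by
    rw [← inner_conj_symm u v, Complex.conj_mul']; push_cast; rfl
  have h5 := congrArg ((↑) : ℝ → ℂ) h3
  rw [h4, h4]
  simp only [inner_self_eq_norm_sq_to_K, Complex.coe_algebraMap]
  push_cast at h5 ⊢
  linear_combination h5

theorem one_sub_inner_ne_zero {E : Type*} [NormedAddCommGroup E] [InnerProductSpace ℂ E] {u v : E}
    (hu : ‖u‖ < 1) (hv : ‖v‖ < 1) : 1 - inner ℂ u v ≠ (0 : ℂ) := by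
  intro h
  have h1 := norm_inner_le_norm (𝕜 := ℂ) u v
  rw [← sub_eq_zero.1 h, norm_one] at h1
  nlinarith [norm_nonneg u, norm_nonneg v]

theorem integrated_relation {n m N : ℕ} {D : Set ℂ} (hD : IsOpen D) (hDc : IsPreconnected D)
    {F : ℂ → EuclideanSpace ℂ (Fin n)} {G : ℂ → EuclideanSpace ℂ (Fin m)}
    {L : ℂ → EuclideanSpace ℂ (Fin N)} (hF : DifferentiableOn ℂ F D)
    (hG : DifferentiableOn ℂ G D) (hL : DifferentiableOn ℂ L D)
    (hball : ∀ z ∈ D, ‖G z‖ < 1) {a b c : ℝ}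
    (hLne : ∀ z ∈ D, ∀ w ∈ D, 1 + inner ℂ (L z) (L w) ≠ (0 : ℂ))
    (hrel : ∀ z ∈ D, ∀ w ∈ D, (a : ℂ) * inner ℂ (deriv F z) (deriv F w)
        * ((1 - inner ℂ (G z) (G w)) * (1 - inner ℂ (G z) (G w)))
        * ((1 + inner ℂ (L z) (L w)) * (1 + inner ℂ (L z) (L w)))
      + b * (inner ℂ (deriv G z) (deriv G w) * (1 - inner ℂ (G z) (G w))
          + inner ℂ (deriv G z) (G w) * inner ℂ (G z) (deriv G w))
        * ((1 + inner ℂ (L z) (L w)) * (1 + inner ℂ (L z) (L w)))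
      + c * (inner ℂ (deriv L z) (deriv L w) * (1 + inner ℂ (L z) (L w))
          - inner ℂ (deriv L z) (L w) * inner ℂ (L z) (deriv L w))
        * ((1 - inner ℂ (G z) (G w)) * (1 - inner ℂ (G z) (G w))) = 0)
    {z₀ z w : ℂ} (hz₀ : z₀ ∈ D) (hz : z ∈ D) (hw : w ∈ D) :
    (a : ℂ) * inner ℂ (F z) (deriv F w)
      + b * (inner ℂ (G z) (deriv G w) / (1 - inner ℂ (G z) (G w)))
      + c * (inner ℂ (L z) (deriv L w) / (1 + inner ℂ (L z) (L w))) =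
    (a : ℂ) * inner ℂ (F z₀) (deriv F w)
      + b * (inner ℂ (G z₀) (deriv G w) / (1 - inner ℂ (G z₀) (G w)))
      + c * (inner ℂ (L z₀) (deriv L w) / (1 + inner ℂ (L z₀) (L w))) := by
  have hinner : ∀ {k : ℕ} {f : ℂ → EuclideanSpace ℂ (Fin k)} (u : EuclideanSpace ℂ (Fin k)),
      DifferentiableOn ℂ f D → ∀ x ∈ D,
        HasDerivAt (fun x => inner ℂ u (f x)) (inner ℂ u (deriv f x)) x := by
    intro k f u hf x hx
    exact (innerSL ℂ u).hasFDerivAt.comp_hasDerivAt x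
      (hf.differentiableAt (hD.mem_nhds hx)).hasDerivAt
  set Φ : ℂ → ℂ := fun x => (a : ℂ) * inner ℂ (deriv F w) (F x)
      + b * (inner ℂ (deriv G w) (G x) / (1 - inner ℂ (G w) (G x)))
      + c * (inner ℂ (deriv L w) (L x) / (1 + inner ℂ (L w) (L x)))
  have hΦ : ∀ x ∈ D, HasDerivAt Φ 0 x := by
    intro x hx
    have hP := one_sub_inner_ne_zero (hball w hw) (hball x hx)
    have hQ := hLne w hw x hx
    have h := (((hinner (deriv F w) hF x hx).const_mul (a : ℂ)).add
      (((hinner (deriv G w) hG x hx).div ((hinner (G w) hG x hx).const_sub 1) hP).const_mul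
        (b : ℂ))).add
      (((hinner (deriv L w) hL x hx).div ((hinner (L w) hL x hx).const_add 1) hQ).const_mul (c : ℂ))
    refine h.congr_deriv ?_
    field_simp
    linear_combination hrel w hw x hx
  have hconst : Φ z = Φ z₀ := hD.is_const_of_deriv_eq_zero hDc
    (fun x hx => (hΦ x hx).differentiableAt.differentiableWithinAt)
    (fun x hx => (hΦ x hx).deriv) hz hz₀
  simpa [Φ] using congrArg (starRingEnd ℂ) hconst

/-- The bilinear pairing of a coefficient vector with a vector of `ℂ ^ k`. -/
noncomputable def coordPairing {k : ℕ} (y : Fin k → ℂ) : EuclideanSpace ℂ (Fin k) →L[ℂ] ℂ :=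
  ∑ i, y i • EuclideanSpace.proj i

theorem coordPairing_apply {k : ℕ} (y : Fin k → ℂ) (u : EuclideanSpace ℂ (Fin k)) :
    coordPairing y u = ∑ i, y i * u i := by
  simp [coordPairing]

theorem coordPairing_mul_conj {k : ℕ} (s : ℂ) (f u : EuclideanSpace ℂ (Fin k)) :
    coordPairing (fun i => s * starRingEnd ℂ (f i)) u = s * inner ℂ f u := by
  rw [coordPairing_apply, PiLp.inner_apply, Finset.mul_sum]
  exact Finset.sum_congr rfl fun i _ => by simp; ring

/-- The affine functional `1 + ⟨y, ·⟩`, homogenized. -/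
noncomputable def affinePairing {k : ℕ} (y : Fin k → ℂ) :
    ℂ × EuclideanSpace ℂ (Fin k) →L[ℂ] ℂ :=
  ContinuousLinearMap.fst ℂ _ _ + (coordPairing y).comp (ContinuousLinearMap.snd ℂ _ _)

theorem affinePairing_apply {k : ℕ} (y : Fin k → ℂ) (u : ℂ × EuclideanSpace ℂ (Fin k)) :
    affinePairing y u = u.1 + coordPairing y u.2 := rfl

/-- The polynomial `⟨X, u⟩` in the variables selected by `s`. -/
noncomputable def pairingPolynomial {k : ℕ} {ι : Type} (s : Fin k → ι)
    (u : EuclideanSpace ℂ (Fin k)) : MvPolynomial ι ℂ :=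
  ∑ i, MvPolynomial.X (s i) * MvPolynomial.C (u i)

theorem eval_pairingPolynomial {k : ℕ} {ι : Type} (s : Fin k → ι)
    (u : EuclideanSpace ℂ (Fin k)) (v : ι → ℂ) :
    MvPolynomial.eval v (pairingPolynomial s u) = coordPairing (fun i => v (s i)) u := by
  simp [pairingPolynomial, coordPairing_apply]

/-- A relation satisfied by a continuous family of coefficients persists for some coefficients
at which a given nonconstant polynomial is arbitrarily large. -/
theorem exists_coefficients_lt_norm_eval {n m N : ℕ} {D : Set ℂ} (hDc : IsPreconnected D)
    {x : ℂ → Fin n → ℂ} {y : ℂ → Fin m → ℂ} {t : ℂ → Fin N → ℂ} (hx : ContinuousOn x D)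
    (hy : ContinuousOn y D) (ht : ContinuousOn t D) {f : ℂ → EuclideanSpace ℂ (Fin n)}
    {g : ℂ → EuclideanSpace ℂ (Fin m)} {h : ℂ → EuclideanSpace ℂ (Fin N)}
    {g' : ℂ → EuclideanSpace ℂ (Fin m)} {h' : ℂ → EuclideanSpace ℂ (Fin N)}
    {H : ℂ → ℂ} {β c : ℂ}
    (hrel : ∀ z ∈ D, ∀ w ∈ D, (coordPairing (x z) (f w) - H w) * (1 + coordPairing (y z) (g w))
        * (1 + coordPairing (t z) (h w))
      + β * coordPairing (y z) (g' w) * (1 + coordPairing (t z) (h w))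
      + c * coordPairing (t z) (h' w) * (1 + coordPairing (y z) (g w)) = 0)
    (p : MvPolynomial (Fin n ⊕ Fin m ⊕ Fin N) ℂ) {z₁ z₂ : ℂ} (hz₁ : z₁ ∈ D) (hz₂ : z₂ ∈ D)
    (hne : MvPolynomial.eval (Sum.elim (x z₁) (Sum.elim (y z₁) (t z₁))) p
      ≠ MvPolynomial.eval (Sum.elim (x z₂) (Sum.elim (y z₂) (t z₂))) p) (R : ℝ) :
    ∃ (x : Fin n → ℂ) (y : Fin m → ℂ) (t : Fin N → ℂ),
      (∀ w ∈ D, (coordPairing x (f w) - H w) * (1 + coordPairing y (g w))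
          * (1 + coordPairing t (h w))
        + β * coordPairing y (g' w) * (1 + coordPairing t (h w))
        + c * coordPairing t (h' w) * (1 + coordPairing y (g w)) = 0) ∧
      R < ‖MvPolynomial.eval (Sum.elim x (Sum.elim y t)) p‖ := by
  set V : ℂ → Fin n ⊕ Fin m ⊕ Fin N → ℂ := fun z => Sum.elim (x z) (Sum.elim (y z) (t z))
  have hV : ContinuousOn V D := by
    refine continuousOn_pi.2 ?_
    rintro (i | i | i)
    exacts [continuousOn_pi.1 hx i, continuousOn_pi.1 hy i, continuousOn_pi.1 ht i]
  have hinf := Set.infinite_image_of_isPreconnected hDc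
    ((MvPolynomial.continuous_eval p).comp_continuousOn hV) hz₁ hz₂ hne
  obtain ⟨v, hv, hR⟩ := MvPolynomial.exists_mem_zeroLocus_lt_norm_eval (V '' D) p
    (by rwa [Set.image_image]) R
  refine ⟨fun i => v (.inl i), fun i => v (.inr (.inl i)), fun i => v (.inr (.inr i)),
    fun w hw => ?_, ?_⟩
  · have := hv ((pairingPolynomial Sum.inl (f w) - MvPolynomial.C (H w))
        * (1 + pairingPolynomial (Sum.inr ∘ Sum.inl) (g w))
        * (1 + pairingPolynomial (Sum.inr ∘ Sum.inr) (h w))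
      + MvPolynomial.C β * pairingPolynomial (Sum.inr ∘ Sum.inl) (g' w)
        * (1 + pairingPolynomial (Sum.inr ∘ Sum.inr) (h w))
      + MvPolynomial.C c * pairingPolynomial (Sum.inr ∘ Sum.inr) (h' w)
        * (1 + pairingPolynomial (Sum.inr ∘ Sum.inl) (g w))) (by
          rintro _ ⟨z, hz, rfl⟩
          simpa [eval_pairingPolynomial, V] using hrel z hz w hw)
    simpa [eval_pairingPolynomial] using this
  · convert hR using 4
    ext (i | i | i) <;> rfl

theorem normalized_relation {n m N : ℕ} {F F' : EuclideanSpace ℂ (Fin n)}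
    {G G₀ G₁ G' : EuclideanSpace ℂ (Fin m)} {L L₀ L₁ L' : EuclideanSpace ℂ (Fin N)} {a b c H : ℂ}
    (hG₀ : 1 - inner ℂ G G₀ ≠ (0 : ℂ)) (hG₁ : 1 - inner ℂ G G₁ ≠ (0 : ℂ))
    (hL₀ : 1 + inner ℂ L L₀ ≠ (0 : ℂ)) (hL₁ : 1 + inner ℂ L L₁ ≠ (0 : ℂ))
    (h : a * inner ℂ F F' + b * (inner ℂ G G' / (1 - inner ℂ G G₁))
      + c * (inner ℂ L L' / (1 + inner ℂ L L₁)) = H) :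
    (coordPairing (fun i => a * starRingEnd ℂ (F i)) F' - H)
        * (1 + coordPairing (fun i => -(1 - inner ℂ G G₀)⁻¹ * starRingEnd ℂ (G i)) (G₁ - G₀))
        * (1 + coordPairing (fun i => (1 + inner ℂ L L₀)⁻¹ * starRingEnd ℂ (L i)) (L₁ - L₀))
      + (-b) * coordPairing (fun i => -(1 - inner ℂ G G₀)⁻¹ * starRingEnd ℂ (G i)) G'
        * (1 + coordPairing (fun i => (1 + inner ℂ L L₀)⁻¹ * starRingEnd ℂ (L i)) (L₁ - L₀))
      + c * coordPairing (fun i => (1 + inner ℂ L L₀)⁻¹ * starRingEnd ℂ (L i)) L'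
        * (1 + coordPairing (fun i => -(1 - inner ℂ G G₀)⁻¹ * starRingEnd ℂ (G i)) (G₁ - G₀))
      = 0 := by
  simp only [coordPairing_mul_conj, inner_sub_right, ← h]
  field_simp
  ring

theorem continuousOn_mul_conj {k : ℕ} {D : Set ℂ} {s : ℂ → ℂ} {f : ℂ → EuclideanSpace ℂ (Fin k)}
    (hs : ContinuousOn s D) (hf : ContinuousOn f D) :
    ContinuousOn (fun z i => s z * starRingEnd ℂ (f z i)) D :=
  continuousOn_pi.2 fun i => hs.mul (Complex.continuous_conj.comp_continuousOn
    ((EuclideanSpace.proj (𝕜 := ℂ) i).continuous.comp_continuousOn hf))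

theorem hasDerivAt_one_prod_sub {k : ℕ} {D : Set ℂ} (hD : IsOpen D)
    {f : ℂ → EuclideanSpace ℂ (Fin k)} (hf : DifferentiableOn ℂ f D) (u : EuclideanSpace ℂ (Fin k))
    {w : ℂ} (hw : w ∈ D) :
    HasDerivAt (fun w => ((1 : ℂ), f w - u)) (0, deriv f w) w :=
  (hasDerivAt_const w (1 : ℂ)).prodMk
    ((hf.differentiableAt (hD.mem_nhds hw)).hasDerivAt.sub_const u)

theorem exists_normalized_relation_lt_norm_eval {n m N : ℕ} {D : Set ℂ}
    (hDc : IsPreconnected D)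
    {F : ℂ → EuclideanSpace ℂ (Fin n)} {G : ℂ → EuclideanSpace ℂ (Fin m)}
    {L : ℂ → EuclideanSpace ℂ (Fin N)} (hF : ContinuousOn F D)
    (hG : ContinuousOn G D) (hL : ContinuousOn L D)
    (hball : ∀ z ∈ D, ‖G z‖ < 1) {a b c : ℂ}
    (hLne : ∀ z ∈ D, ∀ w ∈ D, 1 + inner ℂ (L z) (L w) ≠ (0 : ℂ)) {H : ℂ → ℂ}
    (hrel : ∀ z ∈ D, ∀ w ∈ D, a * inner ℂ (F z) (deriv F w)
      + b * (inner ℂ (G z) (deriv G w) / (1 - inner ℂ (G z) (G w)))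
      + c * (inner ℂ (L z) (deriv L w) / (1 + inner ℂ (L z) (L w))) = H w)
    {z₀ z₁ : ℂ} (hz₀ : z₀ ∈ D) (hz₁ : z₁ ∈ D)
    (p : MvPolynomial (Fin n ⊕ Fin m ⊕ Fin N) ℂ)
    (hne : MvPolynomial.eval (Sum.elim (fun i => a * starRingEnd ℂ (F z₁ i))
        (Sum.elim (fun i => -(1 - inner ℂ (G z₁) (G z₀))⁻¹ * starRingEnd ℂ (G z₁ i))
          fun i => (1 + inner ℂ (L z₁) (L z₀))⁻¹ * starRingEnd ℂ (L z₁ i))) p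
      ≠ MvPolynomial.eval (Sum.elim (fun i => a * starRingEnd ℂ (F z₀ i))
        (Sum.elim (fun i => -(1 - inner ℂ (G z₀) (G z₀))⁻¹ * starRingEnd ℂ (G z₀ i))
          fun i => (1 + inner ℂ (L z₀) (L z₀))⁻¹ * starRingEnd ℂ (L z₀ i))) p) (R : ℝ) :
    ∃ (x : Fin n → ℂ) (y : Fin m → ℂ) (t : Fin N → ℂ),
      (∀ w ∈ D, (coordPairing x (deriv F w) - H w) * (1 + coordPairing y (G w - G z₀))
          * (1 + coordPairing t (L w - L z₀))
        + (-b) * coordPairing y (deriv G w) * (1 + coordPairing t (L w - L z₀))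
        + c * coordPairing t (deriv L w) * (1 + coordPairing y (G w - G z₀)) = 0) ∧
      R < ‖MvPolynomial.eval (Sum.elim x (Sum.elim y t)) p‖ := by
  have hGne := fun z (hz : z ∈ D) w (hw : w ∈ D) => one_sub_inner_ne_zero (hball z hz) (hball w hw)
  have hinner : ∀ {k : ℕ} {f : ℂ → EuclideanSpace ℂ (Fin k)} (u : EuclideanSpace ℂ (Fin k)),
      ContinuousOn f D → ContinuousOn (fun z => (inner ℂ (f z) u : ℂ)) D :=
    fun u hf => hf.inner continuousOn_const
  exact exists_coefficients_lt_norm_eval hDc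
    (continuousOn_mul_conj (s := fun _ => a) continuousOn_const hF)
    (continuousOn_mul_conj ((continuousOn_const.sub (hinner (G z₀) hG)).inv₀
      fun z hz => hGne z hz z₀ hz₀).neg hG)
    (continuousOn_mul_conj ((continuousOn_const.add (hinner (L z₀) hL)).inv₀
      fun z hz => hLne z hz z₀ hz₀) hL)
    (fun z hz w hw => normalized_relation (hGne z hz z₀ hz₀) (hGne z hz w hw)
      (hLne z hz z₀ hz₀) (hLne z hz w hw) (hrel z hz w hw)) p hz₁ hz₀ hne R

theorem euclidean_coefficient_eq_zero {n m N : ℕ} {D : Set ℂ} (hD : IsOpen D)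
    (hDc : IsPreconnected D)
    {F : ℂ → EuclideanSpace ℂ (Fin n)} {G : ℂ → EuclideanSpace ℂ (Fin m)}
    {L : ℂ → EuclideanSpace ℂ (Fin N)} (hF : DifferentiableOn ℂ F D)
    (hG : DifferentiableOn ℂ G D) (hL : DifferentiableOn ℂ L D)
    (hball : ∀ z ∈ D, ‖G z‖ < 1) {a b c : ℂ}
    (hLne : ∀ z ∈ D, ∀ w ∈ D, 1 + inner ℂ (L z) (L w) ≠ (0 : ℂ)) {H : ℂ → ℂ}
    (hrel : ∀ z ∈ D, ∀ w ∈ D, a * inner ℂ (F z) (deriv F w)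
      + b * (inner ℂ (G z) (deriv G w) / (1 - inner ℂ (G z) (G w)))
      + c * (inner ℂ (L z) (deriv L w) / (1 + inner ℂ (L z) (L w))) = H w)
    {z₀ z₁ w₁ : ℂ} (hz₀ : z₀ ∈ D) (hz₁ : z₁ ∈ D) (hw₁ : w₁ ∈ D)
    (hne : (inner ℂ (F z₁) (deriv F w₁) : ℂ) ≠ inner ℂ (F z₀) (deriv F w₁)) : a = 0 := by
  by_contra ha
  choose x y t hxyt hlt using fun j : ℕ => exists_normalized_relation_lt_norm_eval hDc
    hF.continuousOn hG.continuousOn hL.continuousOn hball hLne hrel hz₀ hz₁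
    (pairingPolynomial Sum.inl (deriv F w₁))
    (by simpa [eval_pairingPolynomial, coordPairing_mul_conj, ha] using hne) j
  refine false_of_logDeriv_relation_of_unbounded (H := H) (β := -b) (c := c) hD hDc (hF.deriv hD)
    (fun w hw => (hasDerivAt_one_prod_sub hD hG (G z₀) hw).differentiableAt.differentiableWithinAt)
    (fun w hw => (hasDerivAt_one_prod_sub hD hL (L z₀) hw).differentiableAt.differentiableWithinAt)
    (fun j => coordPairing (x j)) (fun j => affinePairing (y j)) (fun j => affinePairing (t j))
    (fun j w hw => ?_) hz₀ hw₁ (fun j => by simp [affinePairing_apply])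
    (fun j => by simp [affinePairing_apply]) (fun j => ?_)
  · rw [(hasDerivAt_one_prod_sub hD hG (G z₀) hw).deriv,
      (hasDerivAt_one_prod_sub hD hL (L z₀) hw).deriv]
    simpa [affinePairing_apply] using hxyt j w hw
  · simpa [eval_pairingPolynomial] using hlt j

theorem eq_of_norm_one_sub_inner_sq_eq {E : Type*} [NormedAddCommGroup E] [InnerProductSpace ℂ E]
    {u v : E} (hu : ‖u‖ < 1)
    (h : ‖(1 - inner ℂ u v : ℂ)‖ ^ 2 = (1 - ‖u‖ ^ 2) * (1 - ‖v‖ ^ 2)) : v = u := by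
  obtain ⟨w, rfl⟩ : ∃ w, v = u + w := ⟨v - u, by abel⟩
  have h1 := norm_add_sq (𝕜 := ℂ) u w
  rw [inner_add_right, inner_self_eq_norm_sq_to_K, Complex.sq_norm, Complex.normSq_apply, h1] at h
  simp only [Complex.coe_algebraMap, RCLike.re_eq_complex_re, ← Complex.ofReal_pow,
    Complex.sub_re, Complex.add_re, Complex.one_re, Complex.ofReal_re,
    Complex.sub_im, Complex.add_im, Complex.one_im, Complex.ofReal_im] at h
  have h2 : 0 < 1 - ‖u‖ ^ 2 := by nlinarith [norm_nonneg u]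
  have h3 : (1 - ‖u‖ ^ 2) * ‖w‖ ^ 2 ≤ 0 := by
    nlinarith [sq_nonneg (inner ℂ u w : ℂ).re, sq_nonneg (inner ℂ u w : ℂ).im]
  have h4 : ‖w‖ ^ 2 = 0 := le_antisymm (nonpos_of_mul_nonpos_right h3 h2) (sq_nonneg _)
  simpa using h4

theorem hyperbolic_mul_projective_coefficient_nonneg {m N : ℕ} {D : Set ℂ} (hD : IsOpen D)
    (hDc : IsPreconnected D) {G : ℂ → EuclideanSpace ℂ (Fin m)}
    {L : ℂ → EuclideanSpace ℂ (Fin N)}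
    (hG : DifferentiableOn ℂ G D) (hL : DifferentiableOn ℂ L D)
    (hball : ∀ z ∈ D, ‖G z‖ < 1) {b c : ℝ}
    (hLne : ∀ z ∈ D, ∀ w ∈ D, 1 + inner ℂ (L z) (L w) ≠ (0 : ℂ)) {H : ℂ → ℂ}
    (hH : ContinuousOn H D)
    (hrel : ∀ z ∈ D, ∀ w ∈ D,
      b * (inner ℂ (G z) (deriv G w) / (1 - inner ℂ (G z) (G w)))
      + c * (inner ℂ (L z) (deriv L w) / (1 + inner ℂ (L z) (L w))) = H w)
    {z₀ z₁ : ℂ} (hz₀ : z₀ ∈ D) (hz₁ : z₁ ∈ D) (hne : G z₁ ≠ G z₀) : 0 ≤ b * c := by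
  by_contra! hbc
  have h10 := one_sub_inner_ne_zero (hball z₁ hz₁) (hball z₀ hz₀)
  have h00 := one_sub_inner_ne_zero (hball z₀ hz₀) (hball z₀ hz₀)
  choose x y t hxyt hlt using fun j : ℕ => exists_normalized_relation_lt_norm_eval (a := 0)
    (F := fun _ => (0 : EuclideanSpace ℂ (Fin 0))) hDc continuousOn_const
    hG.continuousOn hL.continuousOn hball hLne (by simpa using hrel) hz₀ hz₁
    (1 + pairingPolynomial (Sum.inr ∘ Sum.inl) (G z₁ - G z₀))
    (by
      simp only [map_add, map_one, eval_pairingPolynomial, Function.comp_apply, Sum.elim_inr,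
        Sum.elim_inl, coordPairing_mul_conj, inner_sub_right]
      intro h
      field_simp at h
      have h' : (1 - inner ℂ (G z₁) (G z₀)) * (1 - inner ℂ (G z₀) (G z₁)) =
          (1 - inner ℂ (G z₁) (G z₁)) * (1 - inner ℂ (G z₀) (G z₀) : ℂ) := by
        linear_combination -h
      refine hne.symm (eq_of_norm_one_sub_inner_sq_eq (hball z₁ hz₁) ?_)
      rw [← Complex.ofReal_inj]
      push_cast
      rw [← Complex.mul_conj']
      simpa [inner_self_eq_norm_sq_to_K] using h') j
  have hGd := fun w (hw : w ∈ D) => hasDerivAt_one_prod_sub hD hG (G z₀) hw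
  have hLd := fun w (hw : w ∈ D) => hasDerivAt_one_prod_sub hD hL (L z₀) hw
  have hG1 : DifferentiableOn ℂ (fun w => ((1 : ℂ), G w - G z₀)) D :=
    fun w hw => (hGd w hw).differentiableAt.differentiableWithinAt
  have hL1 : DifferentiableOn ℂ (fun w => ((1 : ℂ), L w - L z₀)) D :=
    fun w hw => (hLd w hw).differentiableAt.differentiableWithinAt
  obtain ⟨j, w, hw, h0⟩ := exists_zero_of_unbounded hD hDc hG1 (fun j => affinePairing (y j))
    hz₀ hz₁ (fun j => by simp [affinePairing_apply]) (fun j => by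
      have := hlt j
      rwa [map_add, map_one, eval_pairingPolynomial] at this)
  refine false_of_zero_of_logDeriv_relation (β := -b) (c := c) hD hDc
    ((affinePairing (y j)).differentiable.comp_differentiableOn hG1)
    ((affinePairing (t j)).differentiable.comp_differentiableOn hL1) hH.neg
    (fun w hw => ?_) hz₀ hw (by simp [affinePairing_apply]) (by simp [affinePairing_apply]) h0
    (by linarith)
  have e1 := ((affinePairing (y j)).hasFDerivAt.comp_hasDerivAt w (hGd w hw)).deriv
  have e2 := ((affinePairing (t j)).hasFDerivAt.comp_hasDerivAt w (hLd w hw)).deriv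
  rw [e1, e2]
  simpa [affinePairing_apply] using hxyt j w hw

theorem exists_deriv_ne_zero {E : Type*} [NormedAddCommGroup E] [NormedSpace ℂ E] {D : Set ℂ}
    (hD : IsOpen D) (hDc : IsPreconnected D) {f : ℂ → E} (hf : DifferentiableOn ℂ f D)
    (hne : ∃ z ∈ D, ∃ w ∈ D, f z ≠ f w) : ∃ z ∈ D, deriv f z ≠ 0 := by
  by_contra! h
  obtain ⟨z, hz, w, hw, hzw⟩ := hne
  exact hzw (hD.is_const_of_deriv_eq_zero hDc hf (fun x hx => h x hx) hz hw)

theorem exists_ne_of_isOpen_subset {E : Type*} [NormedAddCommGroup E] [NormedSpace ℂ E]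
    [CompleteSpace E] {D B : Set ℂ} (hD : IsOpen D) (hDc : IsPreconnected D) {f : ℂ → E}
    (hf : DifferentiableOn ℂ f D) (hne : ∃ z ∈ D, ∃ w ∈ D, f z ≠ f w) (hB : IsOpen B)
    (hBD : B ⊆ D) {z₀ : ℂ} (hz₀ : z₀ ∈ B) : ∃ z ∈ B, f z ≠ f z₀ := by
  by_contra! h
  obtain ⟨z, hz, w, hw, hzw⟩ := hne
  have := (hf.analyticOnNhd hD).eqOn_of_preconnected_of_eventuallyEq
    (analyticOnNhd_const (v := f z₀)) hDc (hBD hz₀)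
    (Filter.eventually_of_mem (hB.mem_nhds hz₀) h)
  exact hzw ((this hz).trans (this hw).symm)

theorem exists_inner_deriv_ne {k : ℕ} {B : Set ℂ} (hB : IsOpen B) (hBc : IsPreconnected B)
    {f : ℂ → EuclideanSpace ℂ (Fin k)} (hf : DifferentiableOn ℂ f B)
    (hne : ∃ z ∈ B, ∃ w ∈ B, f z ≠ f w) (z₀ : ℂ) :
    ∃ z ∈ B, ∃ w ∈ B, (inner ℂ (f z) (deriv f w) : ℂ) ≠ inner ℂ (f z₀) (deriv f w) := by
  by_contra! h
  obtain ⟨w, hw, hw0⟩ := exists_deriv_ne_zero hB hBc hf hne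
  refine hw0 (inner_self_eq_zero (𝕜 := ℂ).1 ?_)
  have h1 : HasDerivAt (fun z => (inner ℂ (deriv f w) (f z) : ℂ))
      (inner ℂ (deriv f w) (deriv f w)) w :=
    (innerSL ℂ (deriv f w)).hasFDerivAt.comp_hasDerivAt w
      (hf.differentiableAt (hB.mem_nhds hw)).hasDerivAt
  have h2 : (fun z => (inner ℂ (deriv f w) (f z) : ℂ)) =ᶠ[𝓝 w]
      fun _ => inner ℂ (deriv f w) (f z₀) := by
    filter_upwards [hB.mem_nhds hw] with z hz
    rw [← inner_conj_symm, h z hz w hw, inner_conj_symm]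
  exact h1.unique ((hasDerivAt_const w _).congr_of_eventuallyEq h2)

theorem exists_ball_one_add_inner_ne_zero {E : Type*} [NormedAddCommGroup E]
    [InnerProductSpace ℂ E] {D : Set ℂ} (hD : IsOpen D) {f : ℂ → E} (hf : ContinuousOn f D)
    {z₀ : ℂ} (hz₀ : z₀ ∈ D) : ∃ r > 0, Metric.ball z₀ r ⊆ D ∧
      ∀ z ∈ Metric.ball z₀ r, ∀ w ∈ Metric.ball z₀ r, 1 + inner ℂ (f z) (f w) ≠ (0 : ℂ) := by
  have hc := hf.continuousAt (hD.mem_nhds hz₀)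
  have h0 : 1 + inner ℂ (f z₀) (f z₀) ≠ (0 : ℂ) := by
    have h := Complex.ofReal_ne_zero.2 (by positivity : (1 + ‖f z₀‖ ^ 2 : ℝ) ≠ 0)
    rw [inner_self_eq_norm_sq_to_K]
    push_cast at h
    exact h
  have hcc : ContinuousAt (fun p : ℂ × ℂ => (1 + inner ℂ (f p.1) (f p.2) : ℂ)) (z₀, z₀) :=
    continuousAt_const.add ((hc.comp_of_eq continuousAt_fst rfl).inner
      (hc.comp_of_eq continuousAt_snd rfl))
  obtain ⟨r, hr, h⟩ := Metric.eventually_nhds_iff_ball.1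
    ((hcc.eventually_ne h0).and (prod_mem_nhds (hD.mem_nhds hz₀) (hD.mem_nhds hz₀)))
  refine ⟨r, hr, fun z hz => ?_, fun z hz w hw => ?_⟩
  · exact (h (z, z) (by rw [← ball_prod_same]; exact ⟨hz, hz⟩)).2.1
  · exact (h (z, w) (by rw [← ball_prod_same]; exact ⟨hz, hw⟩)).1

theorem eq_zero_of_mul_add_mul_eq_zero {b c A C : ℝ} (h : b * A + c * C = 0) (hbc : 0 ≤ b * c)
    (hA : 0 < A) (hC : 0 ≤ C) : b = 0 := by
  have h1 : b ^ 2 * A + b * c * C = 0 := by linear_combination b * h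
  have h2 : b ^ 2 * A ≤ 0 := by linarith [mul_nonneg hbc hC]
  exact pow_eq_zero_iff two_ne_zero |>.1 (le_antisymm (nonpos_of_mul_nonpos_left h2 hA)
    (sq_nonneg b))

/-- If `F : D → ℂ^n`, `G : D → 𝔹^m`, `L : D → ℂ^N` are
holomorphic and nonconstant and
`u = a‖F‖² - b log(1 - ‖G‖²) + c log(1 + ‖L‖²)` is harmonic on the connected
open set `D ⊆ ℂ`, then `a = b = c = 0`. -/
theorem coefficients_zero_of_harmonic_potential
    (D : Set ℂ) (hDo : IsOpen D) (hDc : IsConnected D)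
    (n m N : ℕ) (hn : 1 ≤ n) (hm : 1 ≤ m) (hN : 1 ≤ N)
    (a b c : ℝ)
    (F : ℂ → EuclideanSpace ℂ (Fin n))
    (G : ℂ → EuclideanSpace ℂ (Fin m))
    (L : ℂ → EuclideanSpace ℂ (Fin N))
    (hF : DifferentiableOn ℂ F D)
    (hG : DifferentiableOn ℂ G D)
    (hL : DifferentiableOn ℂ L D)
    (hGball : ∀ z ∈ D, ‖G z‖ < 1)
    (hFnc : ∃ z ∈ D, ∃ w ∈ D, F z ≠ F w)
    (hGnc : ∃ z ∈ D, ∃ w ∈ D, G z ≠ G w)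
    (hLnc : ∃ z ∈ D, ∃ w ∈ D, L z ≠ L w)
    (hharm : HarmonicOn
      (fun z => a * ‖F z‖ ^ 2
        - b * Real.log (1 - ‖G z‖ ^ 2)
        + c * Real.log (1 + ‖L z‖ ^ 2)) D) :
    a = 0 ∧ b = 0 ∧ c = 0 := by
  have hDp := hDc.isPreconnected
  have hdiag := fun z (hz : z ∈ D) => laplacian_potential_eq hDo hF hG hL hGball hharm hz
  have hpol := polarized_relation hDo hDp hF hG hL hGball hdiag
  obtain ⟨z₀, hz₀⟩ := hDc.nonempty
  obtain ⟨r, hr, hBD, hLne⟩ := exists_ball_one_add_inner_ne_zero hDo hL.continuousOn hz₀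
  set B := Metric.ball z₀ r
  have hB : IsOpen B := Metric.isOpen_ball
  have hBc : IsPreconnected B := (convex_ball z₀ r).isPreconnected
  have hzB : z₀ ∈ B := Metric.mem_ball_self hr
  have hballB : ∀ z ∈ B, ‖G z‖ < 1 := fun z hz => hGball z (hBD hz)
  have hrel := fun z (hz : z ∈ B) w (hw : w ∈ B) =>
    integrated_relation hB hBc (hF.mono hBD) (hG.mono hBD) (hL.mono hBD) hballB hLne
      (fun z hz w hw => hpol z (hBD hz) w (hBD hw)) hzB hz hw
  obtain ⟨z₁, hz₁, hFne⟩ := exists_ne_of_isOpen_subset hDo hDp hF hFnc hB hBD hzB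
  obtain ⟨z₂, hz₂, w₂, hw₂, hne⟩ := exists_inner_deriv_ne hB hBc (hF.mono hBD)
    ⟨z₁, hz₁, z₀, hzB, hFne⟩ z₀
  have ha : a = 0 := by
    exact_mod_cast euclidean_coefficient_eq_zero hB hBc (hF.mono hBD) (hG.mono hBD) (hL.mono hBD)
      hballB hLne hrel hzB hz₂ hw₂ hne
  subst ha
  simp only [Complex.ofReal_zero, zero_mul, zero_add] at hrel hdiag
  obtain ⟨z₃, hz₃, hGne⟩ := exists_ne_of_isOpen_subset hDo hDp hG hGnc hB hBD hzB
  have hbc := hyperbolic_mul_projective_coefficient_nonneg hB hBc (hG.mono hBD) (hL.mono hBD)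
    hballB hLne (by
      have hGB := hG.continuousOn.mono hBD
      have hLB := hL.continuousOn.mono hBD
      have hGB' := (hG.deriv hDo).continuousOn.mono hBD
      have hLB' := (hL.deriv hDo).continuousOn.mono hBD
      exact (continuousOn_const.mul ((continuousOn_const.inner hGB').div
          (continuousOn_const.sub (continuousOn_const.inner hGB))
          fun w hw => one_sub_inner_ne_zero (hballB z₀ hzB) (hballB w hw))).add
        (continuousOn_const.mul ((continuousOn_const.inner hLB').div
          (continuousOn_const.add (continuousOn_const.inner hLB)) (hLne z₀ hzB))))
    hrel hzB hz₃ hGne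
  have hpos : ∀ z ∈ D, 0 < 1 - ‖G z‖ ^ 2 := fun z hz => by
    nlinarith [hGball z hz, norm_nonneg (G z)]
  have hA : ∀ z ∈ D, ‖deriv G z‖ ^ 2 / (1 - ‖G z‖ ^ 2) ≤
      (‖deriv G z‖ ^ 2 * (1 - ‖G z‖ ^ 2) + ‖inner ℂ (G z) (deriv G z)‖ ^ 2)
        / (1 - ‖G z‖ ^ 2) ^ 2 := fun z hz => by
    have h1 := hpos z hz
    rw [div_le_div_iff₀ h1 (by positivity)]
    nlinarith [mul_nonneg (sq_nonneg ‖inner ℂ (G z) (deriv G z)‖) h1.le]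
  have hC : ∀ z, ‖deriv L z‖ ^ 2 / (1 + ‖L z‖ ^ 2) ^ 2 ≤
      (‖deriv L z‖ ^ 2 * (1 + ‖L z‖ ^ 2) - ‖inner ℂ (L z) (deriv L z)‖ ^ 2)
        / (1 + ‖L z‖ ^ 2) ^ 2 := fun z => by
    gcongr
    have h1 := pow_le_pow_left₀ (norm_nonneg _) (norm_inner_le_norm (𝕜 := ℂ) (L z) (deriv L z)) 2
    linarith
  obtain ⟨z₄, hz₄, hG'⟩ := exists_deriv_ne_zero hDo hDp hG hGnc
  obtain ⟨z₅, hz₅, hL'⟩ := exists_deriv_ne_zero hDo hDp hL hLnc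
  refine ⟨rfl, eq_zero_of_mul_add_mul_eq_zero (hdiag z₄ hz₄) hbc ?_ ?_,
    eq_zero_of_mul_add_mul_eq_zero ((add_comm _ _).trans (hdiag z₅ hz₅)) (mul_comm b c ▸ hbc) ?_ ?_⟩
  · exact (div_pos (by positivity) (hpos z₄ hz₄)).trans_le (hA z₄ hz₄)
  · exact (by positivity : 0 ≤ ‖deriv L z₄‖ ^ 2 / (1 + ‖L z₄‖ ^ 2) ^ 2).trans (hC z₄)
  · exact (by positivity : 0 < ‖deriv L z₅‖ ^ 2 / (1 + ‖L z₅‖ ^ 2) ^ 2).trans_le (hC z₅)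
  · exact (div_nonneg (by positivity) (hpos z₅ hz₅).le).trans (hA z₅ hz₅)
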